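/- Heisenberg Fourier Slice Theorem: for every f ∈ L¹(ℍ), every λ > 0, every n ∈ ℤ∖{0}, every F ∈ 𝓗 and every ζ ∈ ℂ, one has ∫_{ℂ×[0,π/λ²)} (I_λ f)(z,t) · (β_{nλ²}(z,t)*F)(ζ) dz dt = (2π/λ) · (𝒥_n G)(ζ), where G := 𝓕_ℍ f(nλ²) F, i.e. G(ζ) = ∫_{ℂ×ℝ} f(w,s)(β_{nλ²}(w,s)*F)(ζ) dw ds. -/

import Mathlib

noncomputable section

open Complex MeasureTheory Real Set

/-- Heisenberg group multiplication on ℂ × ℝ. -/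
def hmul (p q : ℂ × ℝ) : ℂ × ℝ :=
  (p.1 + q.1, p.2 + q.2 + (p.1.re * q.1.im - p.1.im * q.1.re) / 2)

/-- The model sub-Riemannian geodesic of charge `lam`:
`γ_λ(s) = (R e^{i s / R}, s R / 2)` with `R = 1/λ`. -/
def geo (lam : ℝ) (s : ℝ) : ℂ × ℝ :=
  (((lam : ℂ))⁻¹ * Complex.exp (Complex.I * ((lam * s : ℝ) : ℂ)), s / (2 * lam))

/-- The sub-Riemannian X-ray transform `I_λ f (z,t) = ∫ f((z,t)·γ_λ(s)) ds`. -/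
def xray (lam : ℝ) (f : ℂ × ℝ → ℂ) (p : ℂ × ℝ) : ℂ :=
  ∫ s : ℝ, f (hmul p (geo lam s))

/-- The Bargmann–Fock representation for `h > 0`, acting pointwise. -/
def betaP (h : ℝ) (z : ℂ) (t : ℝ) (F : ℂ → ℂ) (ζ : ℂ) : ℂ :=
  Complex.exp (2 * Complex.I * (h : ℂ) * (t : ℂ) - ((Real.sqrt h : ℝ) : ℂ) * ζ * (starRingEnd ℂ) z
      - ((h : ℂ) / 2) * ((Complex.normSq z : ℝ) : ℂ)) * F (ζ + ((Real.sqrt h : ℝ) : ℂ) * z)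

/-- The Bargmann–Fock representation `β_h(z,t)` for `h ≠ 0`:
for `h < 0` it is `β_{|h|}(conj z, −t)`. -/
def beta (h : ℝ) (z : ℂ) (t : ℝ) (F : ℂ → ℂ) (ζ : ℂ) : ℂ :=
  if 0 < h then betaP h z t F ζ else betaP |h| ((starRingEnd ℂ) z) (-t) F ζ

/-- The adjoint `β_h(z,t)* = β_h((z,t)⁻¹) = β_h(−z,−t)`. -/
def betaStar (h : ℝ) (p : ℂ × ℝ) (F : ℂ → ℂ) (ζ : ℂ) : ℂ :=
  beta h (-p.1) (-p.2) F ζ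

/-- Membership in Bargmann–Fock space `𝓗`: entire with
`(1/π) ∫_ℂ |F(ζ)|² e^{−|ζ|²} dζ < ∞`. -/
def InFock (F : ℂ → ℂ) : Prop :=
  Differentiable ℂ F ∧
    Integrable (fun ζ : ℂ => ‖F ζ‖ ^ 2 * Real.exp (-Complex.normSq ζ))

/-- The group Fourier transform `𝓕_ℍ f(h)`, acting pointwise on `F ∈ 𝓗`:
`(𝓕_ℍ f(h) F)(ζ) = ∫_{ℂ×ℝ} f(z,t) (β_h(z,t)* F)(ζ) dz dt`. -/
def fourierH (f : ℂ × ℝ → ℂ) (h : ℝ) (F : ℂ → ℂ) (ζ : ℂ) : ℂ :=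
  ∫ p : ℂ × ℝ, f p * betaStar h p F ζ

/-- The multiplier operator `𝒥_n(r)`:
`(𝒥_n(r) F)(ζ) = (1/2π) ∫₀^{2π} (β_n(r e^{iθ}, θ/2) F)(ζ) dθ`. -/
def Jop (n : ℤ) (r : ℝ) (F : ℂ → ℂ) (ζ : ℂ) : ℂ :=
  ((1 / (2 * π) : ℝ) : ℂ) *
    ∫ θ in (0 : ℝ)..(2 * π), beta (n : ℝ) (((r : ℝ) : ℂ) * Complex.exp (Complex.I * (θ : ℂ))) (θ / 2) F ζ

section MeasurePreservingFamilies

variable {X Y E : Type*} [MeasurableSpace X] [MeasurableSpace Y] [NormedAddCommGroup E]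

/-- An integrable function precomposed with a measurable family of measure-preserving maps, indexed
by a finite measure space, is jointly integrable. -/
theorem integrable_comp_family {ν : Measure X} [IsFiniteMeasure ν] {μ : Measure Y} [SFinite μ]
    {T : X → Y → Y} (hT : Measurable (Function.uncurry T))
    (hTμ : ∀ x, MeasurePreserving (T x) μ μ) {u : Y → E} (hu : Integrable u μ) :
    Integrable (fun q : X × Y => u (T q.1 q.2)) (ν.prod μ) := by
  have hmp : MeasurePreserving (fun q : X × Y => (q.1, T q.1 q.2)) (ν.prod μ) (ν.prod μ) :=
    (MeasurePreserving.id ν).skew_product hT (Filter.Eventually.of_forall fun x => (hTμ x).map_eq)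
  exact hmp.integrable_comp_of_integrable (hu.comp_snd ν)

end MeasurePreservingFamilies

/-- A measurable set meeting each coset of `ℤ v` exactly once is a fundamental domain. -/
theorem isAddFundamentalDomain_zmultiples {A : Type*} [AddCommGroup A] [Module.IsTorsionFree ℤ A]
    [MeasurableSpace A] {μ : Measure A} {v : A} (hv : v ≠ 0) {S : Set A} (hS : MeasurableSet S)
    (h : ∀ x, ∃! k : ℤ, k • v + x ∈ S) :
    IsAddFundamentalDomain (AddSubgroup.zmultiples v) S μ := by
  refine IsAddFundamentalDomain.mk' hS.nullMeasurableSet fun x => ?_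
  have : Function.Bijective (codRestrict (fun k : ℤ => k • v) (AddSubgroup.zmultiples v)
      fun k => ⟨k, rfl⟩) :=
    (Equiv.ofInjective (fun k : ℤ => k • v) (smul_left_injective ℤ hv)).bijective
  exact this.existsUnique_iff.2 (h x)

section FockBound

/-- The Gaussian mean value property of entire functions. -/
theorem integral_mul_gaussian_of_differentiable {g : ℂ → ℂ} (hg : Differentiable ℂ g)
    (hint : Integrable fun w : ℂ => g w * ((Real.exp (-normSq w) : ℝ) : ℂ)) :
    ∫ w : ℂ, g w * ((Real.exp (-normSq w) : ℝ) : ℂ) = π * g 0 := by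
  set u : ℂ → ℂ := fun w => g w * ((Real.exp (-normSq w) : ℝ) : ℂ) with hu
  have hmp : ∀ θ : ℝ, MeasurePreserving (fun w : ℂ => Complex.exp (θ * I) * w) := fun θ => by
    simpa [Circle.coe_exp] using! (rotation (Circle.exp θ)).measurePreserving
  have hmeas : Measurable (Function.uncurry fun (θ : ℝ) (w : ℂ) => Complex.exp (θ * I) * w) := by
    unfold Function.uncurry; fun_prop
  have hswap := integral_integral_swap
    (f := fun (θ : ℝ) (w : ℂ) => u (Complex.exp (θ * I) * w)) (integrable_comp_family
    (ν := volume.restrict (Ioc 0 (2 * π))) hmeas hmp hint)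
  have hrot : ∀ θ : ℝ, ∫ w, u (Complex.exp (θ * I) * w) = ∫ w, u w := fun θ => by
    simpa [Circle.coe_exp] using!
      (rotation (Circle.exp θ)).measurePreserving.integral_comp'
        (f := (rotation (Circle.exp θ)).toHomeomorph.toMeasurableEquiv) u
  have hcirc : ∀ w : ℂ, ∫ θ in Ioc 0 (2 * π), u (Complex.exp ((θ : ℝ) * I) * w)
      = 2 * π * g 0 * ((Real.exp (-normSq w) : ℝ) : ℂ) := fun w => by
    have h1 : Differentiable ℂ fun ξ => g (ξ * w) := by fun_prop
    have h2 := circleAverage_of_differentiable_on_off_countable (f := fun ξ => g (ξ * w)) (c := 0)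
      (R := 1) countable_empty h1.continuous.continuousOn (fun z _ => h1 z)
    rw [circleAverage_def, intervalIntegral.integral_of_le (by positivity),
      inv_smul_eq_iff₀ (by positivity)] at h2
    simp only [circleMap, zero_add, ofReal_one, one_mul, zero_mul] at h2
    simp only [hu, normSq_mul, normSq_eq_norm_sq (Complex.exp _), norm_exp_ofReal_mul_I,
      one_pow, one_mul]
    rw [integral_mul_const, h2]
    simp
  have hgauss : ∫ w : ℂ, ((Real.exp (-normSq w) : ℝ) : ℂ) = π := by
    rw [integral_complex_ofReal]
    have := GaussianFourier.integral_rexp_neg_mul_sq_norm (V := ℂ) (b := 1) one_pos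
    simpa [normSq_eq_norm_sq] using this
  simp only [hrot, hcirc] at hswap
  rw [integral_const_mul, hgauss, setIntegral_const] at hswap
  have h2pi : (0 : ℝ) ≤ 2 * π := by positivity
  simp only [Real.volume_real_Ioc_of_le h2pi, sub_zero, real_smul] at hswap
  push_cast at hswap
  have : (2 * π : ℂ) * ∫ w, u w = (2 * π) * (π * g 0) := by rw [hswap]; ring
  exact mul_left_cancel₀ (by simp) this

/-- Point evaluations are bounded on Bargmann–Fock space. -/
theorem InFock.norm_le {F : ℂ → ℂ} (hF : InFock F) :
    ∃ C : ℝ, ∀ ξ, ‖F ξ‖ ≤ C * Real.exp (normSq ξ / 2) := by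
  obtain ⟨hd, hi⟩ := hF
  set M := ∫ w, ‖F w‖ ^ 2 * Real.exp (-normSq w) with hM
  refine ⟨Real.sqrt (M / π), fun ξ => ?_⟩
  set g : ℂ → ℂ := fun w =>
    (F (w + ξ) * Complex.exp (-(w * starRingEnd ℂ ξ) - (normSq ξ / 2 : ℝ))) ^ 2 with hg
  have hgd : Differentiable ℂ g := by
    have : Differentiable ℂ fun w => F (w + ξ) := hd.comp (by fun_prop)
    fun_prop
  have hgn : ∀ w, ‖g w * ((Real.exp (-normSq w) : ℝ) : ℂ)‖
      = ‖F (w + ξ)‖ ^ 2 * Real.exp (-normSq (w + ξ)) := fun w => by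
    simp only [hg, norm_mul, norm_pow, mul_pow, norm_exp, norm_real, Real.norm_eq_abs,
      Real.abs_exp]
    rw [mul_assoc, ← Real.exp_nat_mul, ← Real.exp_add]
    congr 2
    simp [normSq_apply]
    ring
  have hgi : Integrable fun w : ℂ => g w * ((Real.exp (-normSq w) : ℝ) : ℂ) := by
    refine ((hi.comp_add_right ξ)).mono' ?_ (Filter.Eventually.of_forall fun w => (hgn w).le)
    have := hgd.continuous
    have : Continuous fun w : ℂ => g w * ((Real.exp (-normSq w) : ℝ) : ℂ) := by
      have := continuous_normSq
      fun_prop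
    exact this.aestronglyMeasurable
  have key : π * ‖g 0‖ ≤ M := by
    calc π * ‖g 0‖ = ‖∫ w : ℂ, g w * ((Real.exp (-normSq w) : ℝ) : ℂ)‖ := by
          rw [integral_mul_gaussian_of_differentiable hgd hgi]; simp [abs_of_pos pi_pos]
      _ ≤ ∫ w : ℂ, ‖g w * ((Real.exp (-normSq w) : ℝ) : ℂ)‖ := norm_integral_le_integral_norm _
      _ = M := by
          simp only [hgn]
          exact integral_add_right_eq_self (fun w => ‖F w‖ ^ 2 * Real.exp (-normSq w)) ξ
  have h0 : ‖g 0‖ = (‖F ξ‖ * Real.exp (-(normSq ξ / 2))) ^ 2 := by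
    simp only [hg, norm_pow, norm_mul, norm_exp]
    simp
  have h1 : ‖F ξ‖ * Real.exp (-(normSq ξ / 2)) ≤ Real.sqrt (M / π) := by
    apply Real.le_sqrt_of_sq_le
    rw [← h0, le_div_iff₀ pi_pos]
    linarith
  calc ‖F ξ‖ = ‖F ξ‖ * Real.exp (-(normSq ξ / 2)) * Real.exp (normSq ξ / 2) := by
        rw [mul_assoc, ← Real.exp_add]; simp
    _ ≤ _ := by gcongr

end FockBound

section Representation

theorem betaP_hmul {h : ℝ} (hh : 0 ≤ h) (z w : ℂ) (t s : ℝ) (F : ℂ → ℂ) (ζ : ℂ) :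
    betaP h z t (betaP h w s F) ζ
      = betaP h (z + w) (t + s + (z.re * w.im - z.im * w.re) / 2) F ζ := by
  unfold betaP
  have hs : ((Real.sqrt h : ℝ) : ℂ) ^ 2 = h := by exact_mod_cast Real.sq_sqrt hh
  rw [← mul_assoc, ← Complex.exp_add]
  congr 1
  · congr 1
    have e1 : starRingEnd ℂ z = z.re - z.im * I := by apply Complex.ext <;> simp
    have e2 : starRingEnd ℂ w = w.re - w.im * I := by apply Complex.ext <;> simp
    have e3 : z = z.re + z.im * I := (re_add_im z).symm
    have e4 : w = w.re + w.im * I := (re_add_im w).symm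
    simp only [map_add, e1, e2, normSq_apply, add_re, add_im]
    push_cast
    have e5 : ((Real.sqrt h : ℝ) : ℂ) * (ζ + (Real.sqrt h : ℝ) * z)
        = (Real.sqrt h : ℝ) * ζ + h * (z.re + z.im * I) := by
      rw [← e3, ← hs]; ring
    rw [e5]
    linear_combination (z.im * w.im * h : ℂ) * I_sq
  · congr 1; ring

/-- The Bargmann–Fock representation is multiplicative. -/
theorem beta_hmul (h : ℝ) (p q : ℂ × ℝ) (F : ℂ → ℂ) (ζ : ℂ) :
    beta h p.1 p.2 (beta h q.1 q.2 F) ζ = beta h (hmul p q).1 (hmul p q).2 F ζ := by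
  by_cases hh : 0 < h
  · have e : beta h q.1 q.2 F = betaP h q.1 q.2 F := by
      funext ξ; simp [beta, hh]
    simpa [e, beta, hh, hmul] using betaP_hmul hh.le p.1 q.1 p.2 q.2 F ζ
  · have := betaP_hmul (abs_nonneg h) (starRingEnd ℂ p.1) (starRingEnd ℂ q.1) (-p.2) (-q.2) F ζ
    have e : beta h q.1 q.2 F = betaP |h| (starRingEnd ℂ q.1) (-q.2) F := by
      funext ξ; simp [beta, hh]
    rw [e]
    simp only [beta, hh, if_false, hmul]
    rw [this]
    congr 1
    · simp
    · simp only [conj_re, conj_im]; ring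

theorem betaP_integral {α : Type*} [MeasurableSpace α] (μ : Measure α) (h : ℝ) (z : ℂ) (t : ℝ)
    (f : α → ℂ) (B : α → ℂ → ℂ) (ζ : ℂ) :
    betaP h z t (fun ξ => ∫ a, f a * B a ξ ∂μ) ζ = ∫ a, f a * betaP h z t (B a) ζ ∂μ := by
  unfold betaP
  rw [← integral_const_mul]
  congr 1; funext a; ring

theorem beta_fourierH (f : ℂ × ℝ → ℂ) (h k : ℝ) (z : ℂ) (t : ℝ) (F : ℂ → ℂ) (ζ : ℂ) :
    beta k z t (fourierH f h F) ζ = ∫ p, f p * beta k z t (betaStar h p F) ζ := by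
  unfold beta fourierH
  split_ifs <;> exact betaP_integral _ _ _ _ _ _ _

theorem norm_betaP_le {F : ℂ → ℂ} {C : ℝ} (hC : ∀ ξ, ‖F ξ‖ ≤ C * Real.exp (normSq ξ / 2))
    {h : ℝ} (hh : 0 ≤ h) (z : ℂ) (t : ℝ) (ζ : ℂ) :
    ‖betaP h z t F ζ‖ ≤ C * Real.exp (normSq ζ / 2) := by
  unfold betaP
  rw [norm_mul, norm_exp]
  refine (mul_le_mul_of_nonneg_left (hC _) (Real.exp_nonneg _)).trans_eq ?_
  rw [mul_left_comm, ← Real.exp_add]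
  congr 2
  have hs := Real.mul_self_sqrt hh
  simp [normSq_apply]
  linear_combination ((z.re ^ 2 + z.im ^ 2) / 2) * hs

theorem norm_betaStar_le {F : ℂ → ℂ} {C : ℝ} (hC : ∀ ξ, ‖F ξ‖ ≤ C * Real.exp (normSq ξ / 2))
    (h : ℝ) (p : ℂ × ℝ) (ζ : ℂ) :
    ‖betaStar h p F ζ‖ ≤ C * Real.exp (normSq ζ / 2) := by
  unfold betaStar beta
  split_ifs with hh
  · exact norm_betaP_le hC hh.le _ _ _
  · exact norm_betaP_le hC (abs_nonneg h) _ _ _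

theorem continuous_betaStar {F : ℂ → ℂ} (hF : Continuous F) (h : ℝ) (ζ : ℂ) :
    Continuous fun p => betaStar h p F ζ := by
  have := continuous_normSq
  have := continuous_conj
  unfold betaStar beta
  split_ifs <;> · unfold betaP; fun_prop

theorem continuous_beta_betaStar {F : ℂ → ℂ} (hF : Continuous F) (h k : ℝ) (z : ℂ) (t : ℝ)
    (ζ : ℂ) : Continuous fun p => beta k z t (betaStar h p F) ζ := by
  have := fun ξ => continuous_betaStar hF h ξ
  unfold beta
  split_ifs <;> · unfold betaP; fun_prop

/-- At frequency `n c`, the representation is periodic in the central variable with period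
`π / c`. -/
theorem betaStar_add_period {c : ℝ} (hc : 0 < c) (n k : ℤ) (z : ℂ) (t : ℝ) (F : ℂ → ℂ) (ζ : ℂ) :
    betaStar (n * c) (z, t + k * (π / c)) F ζ = betaStar (n * c) (z, t) F ζ := by
  have hc' : (c : ℂ) ≠ 0 := by exact_mod_cast hc.ne'
  unfold betaStar beta
  split_ifs with hh
  · unfold betaP
    congr 1
    rw [Complex.exp_eq_exp_iff_exists_int]
    refine ⟨-(n * k), ?_⟩
    push_cast
    field_simp
    ring
  · unfold betaP
    rw [abs_of_nonpos (not_lt.1 hh)]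
    congr 1
    rw [Complex.exp_eq_exp_iff_exists_int]
    refine ⟨-(n * k), ?_⟩
    push_cast
    field_simp
    ring

/-- Rescaling the frequency amounts to dilating the group variable. -/
theorem beta_dilate {r : ℝ} (hr : 0 < r) (a : ℝ) (z : ℂ) (t : ℝ) (F : ℂ → ℂ) (ζ : ℂ) :
    beta (a * r ^ 2) ((r : ℂ)⁻¹ * z) (t / r ^ 2) F ζ = beta a z t F ζ := by
  have key : ∀ b : ℝ, ∀ w : ℂ, ∀ s : ℝ,
      betaP (b * r ^ 2) ((r : ℂ)⁻¹ * w) (s / r ^ 2) F ζ = betaP b w s F ζ := by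
    intro b w s
    have hr' : (r : ℂ) ≠ 0 := by exact_mod_cast hr.ne'
    unfold betaP
    rw [Real.sqrt_mul' b (sq_nonneg r), Real.sqrt_sq hr.le]
    simp only [map_mul, map_inv₀, conj_ofReal, normSq_ofReal]
    push_cast
    congr 2
    · field_simp
    · field_simp
  have hr2 : 0 < r ^ 2 := by positivity
  unfold beta
  rw [abs_mul, abs_of_pos hr2]
  simp only [mul_pos_iff_of_pos_right hr2, map_mul, map_inv₀, conj_ofReal, ← neg_div, key]

end Representation

section Geodesics

theorem hmul_neg_hmul (p q : ℂ × ℝ) : hmul q (-(hmul p q)) = -p := by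
  ext <;> simp [hmul]
  ring

theorem measurePreserving_hmul_right (q : ℂ × ℝ) :
    MeasurePreserving (fun p : ℂ × ℝ => hmul p q) := by
  refine (measurePreserving_add_right volume q.1).skew_product
    (g := fun z t => t + q.2 + (z.re * q.1.im - z.im * q.1.re) / 2) ?_ ?_
  · unfold Function.uncurry; fun_prop
  · refine Filter.Eventually.of_forall fun z => ?_
    simp only [add_assoc]
    exact (measurePreserving_add_right volume _).map_eq

theorem geo_add_period {lam : ℝ} (hlam : 0 < lam) (k : ℤ) (s : ℝ) :
    geo lam (s + k * (2 * π / lam))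
      = ((geo lam s).1, (geo lam s).2 + k * (π / lam ^ 2)) := by
  unfold geo
  ext1
  · simp only
    congr 1
    rw [Complex.exp_eq_exp_iff_exists_int]
    refine ⟨k, ?_⟩
    have : (lam : ℂ) ≠ 0 := by exact_mod_cast hlam.ne'
    push_cast
    field_simp
  · simp only
    field_simp

theorem measurable_hmul_geo (lam : ℝ) :
    Measurable (Function.uncurry fun (s : ℝ) (p : ℂ × ℝ) => hmul p (geo lam s)) := by
  unfold Function.uncurry hmul geo; fun_prop

end Geodesics

/-- **Heisenberg Fourier Slice Theorem.**
For `f ∈ L¹(ℍ)`, `λ > 0`, `n ∈ ℤ∖{0}`, `F ∈ 𝓗`, `ζ ∈ ℂ`: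
`∫_{ℂ×[0,π/λ²)} (I_λ f)(z,t) (β_{nλ²}(z,t)* F)(ζ) dz dt = (2π/λ) (𝒥_n (𝓕_ℍ f(nλ²) F))(ζ)`. -/
theorem heisenberg_fourier_slice (f : ℂ × ℝ → ℂ) (hf : Integrable f)
    (lam : ℝ) (hlam : 0 < lam) (n : ℤ) (hn : n ≠ 0)
    (F : ℂ → ℂ) (hF : InFock F) (ζ : ℂ) :
    ∫ p in (Set.univ : Set ℂ) ×ˢ Set.Ico (0 : ℝ) (π / lam ^ 2),
        xray lam f p * betaStar ((n : ℝ) * lam ^ 2) p F ζ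
      = ((2 * π / lam : ℝ) : ℂ) * Jop n 1 (fourierH f ((n : ℝ) * lam ^ 2) F) ζ := by
  set h : ℝ := n * lam ^ 2 with hh
  set T : ℝ := π / lam ^ 2 with hT
  set L : ℝ := 2 * π / lam with hL
  have hlam2 : 0 < lam ^ 2 := by positivity
  have hT0 : 0 < T := by positivity
  have hL0 : 0 < L := by positivity
  obtain ⟨C, hC⟩ := hF.norm_le
  have hFc : Continuous F := hF.1.continuous
  set K : ℝ × (ℂ × ℝ) → ℂ := fun x => f (hmul x.2 (geo lam x.1)) * betaStar h x.2 F ζ with hK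
  set v : ℝ × (ℂ × ℝ) := (L, (0, -T)) with hv
  have hv0 : v ≠ 0 := fun e => hL0.ne' (congrArg Prod.fst e)
  have hD : MeasurableSet ((univ : Set ℂ) ×ˢ Ico (0 : ℝ) T) :=
    MeasurableSet.univ.prod measurableSet_Ico
  -- `K` is invariant under the translations by `v`
  have hinv : ∀ (g : AddSubgroup.zmultiples v) (x : ℝ × (ℂ × ℝ)), K (g +ᵥ x) = K x := by
    rintro ⟨_, k, rfl⟩ ⟨s, z, t⟩
    have e : (⟨k • v, ⟨k, rfl⟩⟩ : AddSubgroup.zmultiples v) +ᵥ (s, z, t)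
        = (s + k * L, z, t + (-k : ℤ) * T) := by
      simp [AddSubgroup.vadd_def, hv]
      constructor <;> ring
    change K ((⟨k • v, ⟨k, rfl⟩⟩ : AddSubgroup.zmultiples v) +ᵥ (s, z, t)) = _
    rw [e]
    simp only [hK, hh]
    rw [betaStar_add_period hlam2, geo_add_period hlam]
    congr 2
    ext1
    · simp [hmul]
    · simp [hmul]; ring
  have hfd1 : IsAddFundamentalDomain (AddSubgroup.zmultiples v)
      ((univ : Set ℝ) ×ˢ ((univ : Set ℂ) ×ˢ Ico (0 : ℝ) T)) := by
    refine isAddFundamentalDomain_zmultiples hv0 (MeasurableSet.univ.prod hD) fun x => ?_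
    simpa [hv, neg_add_eq_sub] using existsUnique_sub_zsmul_mem_Ico hT0 x.2.2 0
  have hfd2 : IsAddFundamentalDomain (AddSubgroup.zmultiples v)
      (Ico (0 : ℝ) L ×ˢ (univ : Set (ℂ × ℝ))) := by
    refine isAddFundamentalDomain_zmultiples hv0 (measurableSet_Ico.prod MeasurableSet.univ)
      fun x => ?_
    simpa [hv, add_comm] using existsUnique_add_zsmul_mem_Ico hL0 x.1 0
  have hint2 : IntegrableOn K (Ico (0 : ℝ) L ×ˢ (univ : Set (ℂ × ℝ))) := by
    have h1 := integrable_comp_family (ν := volume.restrict (Ico (0 : ℝ) L))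
      (measurable_hmul_geo lam) (fun s => measurePreserving_hmul_right (geo lam s)) hf
    rw [IntegrableOn, Measure.volume_eq_prod, ← Measure.prod_restrict, Measure.restrict_univ]
    refine h1.mul_bdd (c := C * Real.exp (normSq ζ / 2)) ?_
      (Filter.Eventually.of_forall fun x => norm_betaStar_le hC h x.2 ζ)
    exact ((continuous_betaStar hFc h ζ).comp continuous_snd).aestronglyMeasurable
  have : (volume : Measure (ℂ × ℝ)).IsAddLeftInvariant := Measure.prod.instIsAddLeftInvariant
  have : (volume : Measure (ℝ × (ℂ × ℝ))).IsAddLeftInvariant :=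
    Measure.prod.instIsAddLeftInvariant
  have : VAddInvariantMeasure (AddSubgroup.zmultiples v) (ℝ × (ℂ × ℝ)) volume :=
    ⟨fun g s _ => measure_preimage_add volume (g : ℝ × (ℂ × ℝ)) s⟩
  have hint1 := (hfd1.integrableOn_iff hfd2 hinv).2 hint2
  have hfold := hfd1.setIntegral_eq hfd2 hinv
  rw [IntegrableOn, Measure.volume_eq_prod, ← Measure.prod_restrict, Measure.restrict_univ] at hint1
  have hlhs : ∫ p in (univ : Set ℂ) ×ˢ Ico (0 : ℝ) T, xray lam f p * betaStar h p F ζ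
      = ∫ x in (univ : Set ℝ) ×ˢ ((univ : Set ℂ) ×ˢ Ico (0 : ℝ) T), K x := by
    rw [Measure.volume_eq_prod ℝ (ℂ × ℝ), ← Measure.prod_restrict, Measure.restrict_univ,
      integral_prod_symm _ hint1]
    simp only [hK, xray, integral_mul_const]
  have hslice : ∀ s, ∫ p, K (s, p)
      = beta h (geo lam s).1 (geo lam s).2 (fourierH f h F) ζ := fun s => by
    have hmp := measurePreserving_hmul_right (geo lam s)
    have hsm : AEStronglyMeasurable (fun p => f p *
        beta h (geo lam s).1 (geo lam s).2 (betaStar h p F) ζ) :=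
      hf.1.mul (continuous_beta_betaStar hFc h h _ _ ζ).aestronglyMeasurable
    have hmap := integral_map hmp.aemeasurable (hmp.map_eq.symm ▸ hsm)
    rw [hmp.map_eq] at hmap
    rw [beta_fourierH, hmap]
    refine integral_congr_ae (Filter.Eventually.of_forall fun p => ?_)
    simp only [hK]
    congr 1
    have := beta_hmul h (geo lam s) (-(hmul p (geo lam s))) F ζ
    rw [hmul_neg_hmul] at this
    exact this.symm
  have hscale : ∀ s, beta h (geo lam s).1 (geo lam s).2 (fourierH f h F) ζ
      = beta n (((1 : ℝ) : ℂ) * Complex.exp (I * ((lam * s : ℝ) : ℂ))) (lam * s / 2)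
          (fourierH f h F) ζ := fun s => by
    rw [← beta_dilate hlam n]
    simp only [geo, ofReal_one, one_mul]
    congr 1
    field_simp
  rw [hlhs, hfold, Measure.volume_eq_prod ℝ (ℂ × ℝ), setIntegral_prod _ hint2]
  simp only [Measure.restrict_univ, hslice, hscale]
  rw [integral_Ico_eq_integral_Ioc, ← intervalIntegral.integral_of_le hL0.le, Jop,
    intervalIntegral.integral_comp_mul_left (fun θ => beta n (((1 : ℝ) : ℂ) *
      Complex.exp (I * (θ : ℂ))) (θ / 2) (fourierH f h F) ζ) hlam.ne', ← mul_assoc, ← ofReal_mul,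
    real_smul]
  have e1 : lam * L = 2 * π := by rw [hL]; field_simp
  have e2 : L * (1 / (2 * π)) = lam⁻¹ := by rw [hL]; field_simp
  rw [e1, e2, mul_zero]

end
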